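/- arXiv:1205.2265 — 6 statements merged into one kernel-verified Lean document; each statement's English description precedes it below -/
import Mathlib

section
/- Let K ≥ 1, T ≥ 1, η > 0, s > 0. Let R¹_t, R²_t ∈ ℝ_+^K (t = 1,…,T) be vectors with nonnegative entries satisfying ‖R¹_t‖_∞ ≤ s and ‖R²_t‖_∞ ≤ s, let λ_t ≥ 0 be nonnegative reals, and set R_t = R¹_t + λ_t R²_t. Define weights by w_1 = (1,…,1) ∈ ℝ^K, w_{t+1,i} = w_{t,i}·exp(η R_{t,i}), and probability vectors p_t = w_t / (Σ_{j=1}^K w_{t,j}). Then for every probability vector p ∈ Δ_K: Σ_{t=1}^T (p − p_t)·R_t ≤ (ln K)/η + s²(ηT/4 + (η/4)·Σ_{t=1}^T λ_t²). -/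
open MeasureTheory ProbabilityTheory in
/-- **Hoeffding's lemma** for a weighted average over a finite type. -/
theorem sum_mul_exp_le_of_mem_Icc {ι : Type*} [Fintype ι] (p x : ι → ℝ) (a b η : ℝ)
    (hp : ∀ i, 0 ≤ p i) (hp1 : ∑ i, p i = 1) (hx : ∀ i, x i ∈ Set.Icc a b) :
    ∑ i, p i * Real.exp (η * x i) ≤
      Real.exp (η * ∑ i, p i * x i + (b - a) ^ 2 * η ^ 2 / 8) := by
  let : MeasurableSpace ι := ⊤
  let μ : Measure ι := ∑ i, ENNReal.ofReal (p i) • Measure.dirac i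
  have : IsProbabilityMeasure μ := ⟨by
    simp [μ, ← ENNReal.ofReal_sum_of_nonneg (fun i _ => hp i), hp1]⟩
  have integral_eq (f : ι → ℝ) : ∫ i, f i ∂μ = ∑ i, p i * f i := by
    rw [integral_finsetSum_measure fun i _ =>
      Integrable.of_finite.smul_measure ENNReal.ofReal_ne_top]
    simp [integral_smul_measure, ENNReal.toReal_ofReal, hp]
  have h := (hasSubgaussianMGF_of_mem_Icc (μ := μ) (X := x) (measurable_from_top.aemeasurable)
    (Filter.Eventually.of_forall hx)).mgf_le η
  rw [mgf, integral_eq, integral_eq] at h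
  have hfactor : ∑ i, p i * Real.exp (η * x i) = Real.exp (η * ∑ i, p i * x i) *
      ∑ i, p i * Real.exp (η * (x i - ∑ j, p j * x j)) := by
    rw [Finset.mul_sum]
    refine Finset.sum_congr rfl fun i _ => ?_
    rw [mul_left_comm, ← Real.exp_add]
    ring_nf
  rw [hfactor, Real.exp_add]
  refine mul_le_mul_of_nonneg_left (h.trans_eq ?_) (Real.exp_pos _).le
  congr 1
  simp only [NNReal.coe_pow, NNReal.coe_div, coe_nnnorm, NNReal.coe_ofNat, Real.norm_eq_abs,
    div_pow, sq_abs]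
  ring


/-- **Primal Inequality (Lemma 1).** Rounds `t = 1, …, T` are indexed by `t = 0, …, T-1`. -/
theorem lewa_primal_inequality (K T : ℕ) (hK : 1 ≤ K) (hT : 1 ≤ T)
    (η s : ℝ) (hη : 0 < η) (hs : 0 < s)
    (R1 R2 : ℕ → Fin K → ℝ) (lam : ℕ → ℝ) (R : ℕ → Fin K → ℝ)
    (hR1nn : ∀ t < T, ∀ i, 0 ≤ R1 t i) (hR2nn : ∀ t < T, ∀ i, 0 ≤ R2 t i)
    (hlam : ∀ t < T, 0 ≤ lam t)
    (hR1b : ∀ t < T, ∀ i, |R1 t i| ≤ s) (hR2b : ∀ t < T, ∀ i, |R2 t i| ≤ s)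
    (hR : ∀ t < T, ∀ i, R t i = R1 t i + lam t * R2 t i)
    (w : ℕ → Fin K → ℝ) (p : ℕ → Fin K → ℝ)
    (hw0 : ∀ i, w 0 i = 1)
    (hwrec : ∀ t < T, ∀ i, w (t + 1) i = w t i * Real.exp (η * R t i))
    (hp : ∀ t < T, ∀ i, p t i = w t i / ∑ j, w t j)
    (q : Fin K → ℝ) (hq : ∀ i, 0 ≤ q i) (hq1 : ∑ i, q i = 1) :
    ∑ t ∈ Finset.range T, ∑ i, (q i - p t i) * R t i ≤
      Real.log K / η + s ^ 2 * (η * T / 4 + η / 4 * ∑ t ∈ Finset.range T, lam t ^ 2) := by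
  have : Nonempty (Fin K) := ⟨⟨0, hK⟩⟩
  have hw (n : ℕ) (hn : n ≤ T) (i : Fin K) :
      w n i = Real.exp (η * ∑ t ∈ Finset.range n, R t i) := by
    induction n with
    | zero => simp [hw0]
    | succ n ih =>
      rw [hwrec n hn, ih (by omega), Finset.sum_range_succ, mul_add, Real.exp_add]
  have hwpos (n : ℕ) (hn : n ≤ T) (i : Fin K) : 0 < w n i := by
    rw [hw n hn]
    positivity
  have hWpos (n : ℕ) (hn : n ≤ T) : 0 < ∑ i, w n i :=
    Finset.sum_pos (fun i _ => hwpos n hn i) Finset.univ_nonempty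
  have hstep (t : ℕ) (ht : t < T) : Real.log (∑ i, w (t + 1) i) ≤ Real.log (∑ i, w t i) +
      η * (∑ i, p t i * R t i + s ^ 2 * (η / 4 + η / 4 * lam t ^ 2)) := by
    have hW := hWpos t ht.le
    have hmem (i : Fin K) : R t i ∈ Set.Icc 0 (s + lam t * s) := by
      rw [hR t ht]
      have := hlam t ht
      have := hR1nn t ht i
      have := hR2nn t ht i
      exact ⟨by positivity, add_le_add (le_of_abs_le (hR1b t ht i))
        (mul_le_mul_of_nonneg_left (le_of_abs_le (hR2b t ht i)) (hlam t ht))⟩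
    have hoeffding := sum_mul_exp_le_of_mem_Icc (p t) (R t) 0 (s + lam t * s) η
      (fun i => by rw [hp t ht]; exact div_nonneg (hwpos t ht.le i).le hW.le)
      (by simp_rw [hp t ht]; rw [← Finset.sum_div, div_self hW.ne']) hmem
    have hfactor : ∑ i, w (t + 1) i = (∑ i, w t i) * ∑ i, p t i * Real.exp (η * R t i) := by
      rw [Finset.mul_sum]
      refine Finset.sum_congr rfl fun i _ => ?_
      rw [hwrec t ht, hp t ht]
      field_simp
    have hpos : 0 < ∑ i, p t i * Real.exp (η * R t i) :=
      pos_of_mul_pos_right (hfactor ▸ hWpos (t + 1) ht) hW.le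
    rw [hfactor, Real.log_mul hW.ne' hpos.ne']
    have := (Real.log_le_iff_le_exp hpos).2 hoeffding
    nlinarith [mul_nonneg (mul_nonneg (sq_nonneg η) (sq_nonneg s)) (sq_nonneg (lam t - 1))]
  have hupper (n : ℕ) (hn : n ≤ T) : Real.log (∑ i, w n i) ≤ Real.log K +
      η * ∑ t ∈ Finset.range n,
        (∑ i, p t i * R t i + s ^ 2 * (η / 4 + η / 4 * lam t ^ 2)) := by
    induction n with
    | zero => simp [hw0]
    | succ n ih =>
      rw [Finset.sum_range_succ, mul_add, ← add_assoc]
      exact (hstep n hn).trans (add_le_add_left (ih (by omega)) _)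
  have hlower : η * ∑ t ∈ Finset.range T, ∑ i, q i * R t i ≤ Real.log (∑ i, w T i) := by
    calc η * ∑ t ∈ Finset.range T, ∑ i, q i * R t i
        = ∑ i, q i * (η * ∑ t ∈ Finset.range T, R t i) := by
          rw [Finset.sum_comm, Finset.mul_sum]
          refine Finset.sum_congr rfl fun i _ => ?_
          rw [← Finset.mul_sum, mul_left_comm]
      _ ≤ ∑ i, q i * Real.log (∑ j, w T j) := by
          refine Finset.sum_le_sum fun i _ => mul_le_mul_of_nonneg_left ?_ (hq i)
          rw [Real.le_log_iff_exp_le (hWpos T le_rfl), ← hw T le_rfl]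
          exact Finset.single_le_sum (fun j _ => (hwpos T le_rfl j).le) (Finset.mem_univ i)
      _ = Real.log (∑ i, w T i) := by rw [← Finset.sum_mul, hq1, one_mul]
  have hmain := hlower.trans (hupper T le_rfl)
  refine le_of_mul_le_mul_left ?_ hη
  simp only [sub_mul, Finset.sum_sub_distrib]
  simp only [Finset.sum_add_distrib, ← Finset.mul_sum, Finset.sum_const, Finset.card_range,
    nsmul_eq_mul] at hmain
  rw [mul_add η, mul_div_cancel₀ _ hη.ne']
  linarith
end

section
/- Let T ≥ 1, η > 0, δ > 0 with δη ≤ 1, let c_0 ≥ 0 and β_0 ≥ 0, and let β_t (t = 1,…,T) be reals with 0 ≤ β_t ≤ β_0. Define g_t(λ) = (δ/2)λ² + λ(β_t − c_0), and the sequence λ_1 = 0, λ_{t+1} = [λ_t − η g_t'(λ_t)]_+ = [(1 − δη)λ_t − η(β_t − c_0)]_+. Then for every λ ≥ 0: Σ_{t=1}^T (λ_t − λ)(β_t − c_0) + (δ/2)·Σ_{t=1}^T (λ_t² − λ²) ≤ λ²/(2η) + (c_0² + β_0²)·η·T. -/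
/-- Projecting onto the nonnegative reals does not increase the squared distance to a
nonnegative point. -/
theorem sq_max_zero_sub_le {x y : ℝ} (hy : 0 ≤ y) : (max 0 x - y) ^ 2 ≤ (x - y) ^ 2 := by
  rcases le_total 0 x with h | h
  · rw [max_eq_right h]
  · rw [max_eq_left h]
    nlinarith [mul_nonneg (neg_nonneg.2 h) hy, sq_nonneg x]

/-- A projected gradient step of size `η` on `z ↦ δ / 2 * z ^ 2 + z * (b - c)`, started at a
point `x` with `0 ≤ x ≤ c / δ`. -/
theorem projected_step_le {η δ b c B x y : ℝ} (hη : 0 < η) (hδ : 0 < δ)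
    (hb : 0 ≤ b) (hbB : b ≤ B) (hx : 0 ≤ x) (hxc : δ * x ≤ c) (hy : 0 ≤ y) :
    2 * η * ((x - y) * (b - c) + δ / 2 * (x ^ 2 - y ^ 2))
        + (max 0 ((1 - δ * η) * x - η * (b - c)) - y) ^ 2
      ≤ (x - y) ^ 2 + 2 * η ^ 2 * (c ^ 2 + B ^ 2) := by
  have hproj := sq_max_zero_sub_le (x := (1 - δ * η) * x - η * (b - c)) hy
  have hδx : 0 ≤ δ * x := by positivity
  have hgrad : (δ * x + (b - c)) ^ 2 ≤ c ^ 2 + B ^ 2 := by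
    rcases le_total 0 (δ * x + (b - c)) with h | h
    · have := pow_le_pow_left₀ h (show δ * x + (b - c) ≤ B by linarith) 2
      nlinarith [sq_nonneg c]
    · have := pow_le_pow_left₀ (neg_nonneg.2 h) (show -(δ * x + (b - c)) ≤ c by linarith) 2
      nlinarith [sq_nonneg B]
  have hscaled := mul_le_mul_of_nonneg_left hgrad (sq_nonneg η)
  have hbound : 0 ≤ η ^ 2 * (c ^ 2 + B ^ 2) := by positivity
  have hconv : 0 ≤ η * δ * (x - y) ^ 2 := by positivity
  linarith


/-- **Dual Inequality (Lemma 2).** Rounds `t = 1, …, T` are indexed by `t = 0, …, T-1`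
(so `λ_1 = 0` becomes `lam 0 = 0`). -/
theorem lewa_dual_inequality (T : ℕ) (hT : 1 ≤ T) (η δ c0 β0 : ℝ)
    (hη : 0 < η) (hδ : 0 < δ) (hδη : δ * η ≤ 1) (hc0 : 0 ≤ c0) (hβ0 : 0 ≤ β0)
    (β : ℕ → ℝ) (hβnn : ∀ t < T, 0 ≤ β t) (hβb : ∀ t < T, β t ≤ β0)
    (lam : ℕ → ℝ) (hlam0 : lam 0 = 0)
    (hlamrec : ∀ t < T, lam (t + 1) = max 0 ((1 - δ * η) * lam t - η * (β t - c0)))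
    (lamb : ℝ) (hlamb : 0 ≤ lamb) :
    ∑ t ∈ Finset.range T, (lam t - lamb) * (β t - c0)
      + δ / 2 * ∑ t ∈ Finset.range T, (lam t ^ 2 - lamb ^ 2)
      ≤ lamb ^ 2 / (2 * η) + (c0 ^ 2 + β0 ^ 2) * η * T := by
  have key : ∀ n ≤ T, 0 ≤ lam n ∧ δ * lam n ≤ c0 ∧
      2 * η * (∑ t ∈ Finset.range n, (lam t - lamb) * (β t - c0)
        + δ / 2 * ∑ t ∈ Finset.range n, (lam t ^ 2 - lamb ^ 2)) + (lam n - lamb) ^ 2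
      ≤ lamb ^ 2 + 2 * η ^ 2 * (c0 ^ 2 + β0 ^ 2) * n := by
    intro n
    induction n with
    | zero => simp [hlam0, hc0]
    | succ n ih =>
      intro hn
      obtain ⟨hpos, hle, hsum⟩ := ih (by omega)
      have hstep := projected_step_le hη hδ (hβnn n hn) (hβb n hn) hpos hle hlamb
      rw [← hlamrec n hn] at hstep
      refine ⟨by rw [hlamrec n hn]; exact le_max_left _ _, ?_, ?_⟩
      · rw [hlamrec n hn, mul_max_of_nonneg _ _ hδ.le]
        refine max_le (by simpa using hc0) ?_
        have h₁ := mul_le_mul_of_nonneg_left hle (sub_nonneg.2 hδη)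
        have h₂ : 0 ≤ δ * η * β n := mul_nonneg (by positivity) (hβnn n hn)
        linarith
      · rw [Finset.sum_range_succ, Finset.sum_range_succ]
        push_cast
        linarith
  obtain ⟨-, -, h⟩ := key T le_rfl
  have hrhs : lamb ^ 2 / (2 * η) + (c0 ^ 2 + β0 ^ 2) * η * T
      = (lamb ^ 2 + 2 * η ^ 2 * (c0 ^ 2 + β0 ^ 2) * T) / (2 * η) := by
    field_simp
  rw [hrhs, le_div_iff₀ (by positivity)]
  linarith [sq_nonneg (lam T - lamb)]
end

section
/- Let K ≥ 1, T ≥ 1, η > 0, and let R_t ∈ ℝ^K (t = 1,…,T) satisfy 0 ≤ η·R_{t,i} ≤ 1 for all t, i. Define w_1 = (1,…,1), w_{t+1,i} = w_{t,i}·exp(η R_{t,i}), and q_t = w_t/(Σ_j w_{t,j}). Then ln( (Σ_i w_{T+1,i}) / (Σ_i w_{1,i}) ) ≤ Σ_{t=1}^T ( η·q_t·R_t + η²·q_t·(R_t)² ), where (R_t)² denotes the vector of squared components (R_{t,1}², …, R_{t,K}²). -/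
/-- One multiplicative-weights round: the logarithm of the growth factor of the total weight is
bounded by the first and second moments of the exponent under the normalized weights. -/
theorem log_sum_mul_exp_div_sum_le {ι : Type*} [Fintype ι] [Nonempty ι] (w x : ι → ℝ)
    (hw : ∀ i, 0 < w i) (hx : ∀ i, |x i| ≤ 1) :
    Real.log ((∑ i, w i * Real.exp (x i)) / ∑ i, w i) ≤
      ∑ i, w i / (∑ j, w j) * x i + ∑ i, w i / (∑ j, w j) * x i ^ 2 := by
  have hS : 0 < ∑ i, w i := Finset.sum_pos (fun i _ => hw i) Finset.univ_nonempty
  have hE : 0 < ∑ i, w i * Real.exp (x i) :=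
    Finset.sum_pos (fun i _ => mul_pos (hw i) (Real.exp_pos _)) Finset.univ_nonempty
  refine (Real.log_le_sub_one_of_pos (div_pos hE hS)).trans ?_
  have hle : ∑ i, w i * Real.exp (x i) ≤
      ∑ i, w i + (∑ i, w i * x i + ∑ i, w i * x i ^ 2) := by
    simp only [← Finset.sum_add_distrib]
    refine Finset.sum_le_sum fun i _ => ?_
    have h := (abs_le.mp (Real.abs_exp_sub_one_sub_id_le (hx i))).2
    nlinarith [mul_le_mul_of_nonneg_left h (hw i).le]
  simp only [div_mul_eq_mul_div, ← Finset.sum_div, ← add_div]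
  rw [div_sub_one hS.ne']
  gcongr
  linarith

/-- Exp3-style upper bound on the growth of the total weight.
Rounds `t = 1, …, T` are indexed by `t = 0, …, T-1`, so `W_{T+1}/W_1` becomes
`(Σ_i w T i)/(Σ_i w 0 i)`. -/
theorem exp3_weight_growth_bound (K T : ℕ) (hK : 1 ≤ K) (hT : 1 ≤ T) (η : ℝ) (hη : 0 < η)
    (R : ℕ → Fin K → ℝ)
    (hRnn : ∀ t < T, ∀ i, 0 ≤ η * R t i) (hRb : ∀ t < T, ∀ i, η * R t i ≤ 1)
    (w : ℕ → Fin K → ℝ) (q : ℕ → Fin K → ℝ)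
    (hw0 : ∀ i, w 0 i = 1)
    (hwrec : ∀ t < T, ∀ i, w (t + 1) i = w t i * Real.exp (η * R t i))
    (hq : ∀ t < T, ∀ i, q t i = w t i / ∑ j, w t j) :
    Real.log ((∑ i, w T i) / ∑ i, w 0 i) ≤
      ∑ t ∈ Finset.range T,
        (η * ∑ i, q t i * R t i + η ^ 2 * ∑ i, q t i * R t i ^ 2) := by
  have : Nonempty (Fin K) := ⟨⟨0, hK⟩⟩
  have hpos : ∀ t ≤ T, ∀ i, 0 < w t i := by
    intro t
    induction t with
    | zero => simp [hw0]
    | succ t ih =>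
      intro ht i
      rw [hwrec t ht i]
      exact mul_pos (ih (Nat.le_of_succ_le ht) i) (Real.exp_pos _)
  have hsum : ∀ t ≤ T, 0 < ∑ i, w t i := fun t ht =>
    Finset.sum_pos (fun i _ => hpos t ht i) Finset.univ_nonempty
  rw [Real.log_div (hsum T le_rfl).ne' (hsum 0 T.zero_le).ne',
    ← Finset.sum_range_sub (fun t => Real.log (∑ i, w t i))]
  refine Finset.sum_le_sum fun t ht => ?_
  have htT : t < T := Finset.mem_range.mp ht
  have hstep := log_sum_mul_exp_div_sum_le (w t) (fun i => η * R t i) (hpos t htT.le)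
    (fun i => (abs_of_nonneg (hRnn t htT i)).trans_le (hRb t htT i))
  simp only [← hwrec t htT, ← hq t htT] at hstep
  rw [Real.log_div (hsum (t + 1) htT).ne' (hsum t htT.le).ne'] at hstep
  simpa only [Finset.mul_sum, mul_pow, mul_left_comm] using hstep
end

section
/- Let T ≥ 1, η > 0, δ > 0 with δη ≤ 1, c_0 ∈ [0,1]. Let ĉ_t ∈ ℝ_+^K have nonnegative entries and q_t ∈ Δ_K (t = 1,…,T). Define g_t(λ) = (δ/2)λ² + λ(q_t·ĉ_t − c_0), and the multiplier sequence λ_1 = 0, λ_{t+1} = [λ_t − η·g_t'(λ_t)]_+ = [(1 − δη)λ_t − η(q_t·ĉ_t − c_0)]_+. Then for every λ ≥ 0: Σ_{t=1}^T ( g_t(λ_t) − g_t(λ) ) ≤ λ²/(2η) + η·Σ_{t=1}^T (q_t·ĉ_t)² + η·T. -/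
/-- The projected gradient step keeps the multiplier in `[0, c / δ]`. -/
theorem dual_step_mem_Icc {η δ c s x : ℝ} (hη : 0 ≤ η) (hδ : 0 ≤ δ) (hδη : δ * η ≤ 1)
    (hc : 0 ≤ c) (hs : 0 ≤ s) (hx : δ * x ≤ c) :
    0 ≤ max 0 ((1 - δ * η) * x - η * (s - c)) ∧
      δ * max 0 ((1 - δ * η) * x - η * (s - c)) ≤ c := by
  refine ⟨le_max_left _ _, ?_⟩
  rw [mul_max_of_nonneg _ _ hδ, mul_zero]
  refine max_le hc ?_
  have h₁ := mul_le_mul_of_nonneg_left hx (sub_nonneg.mpr hδη)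
  have h₂ := mul_nonneg (mul_nonneg hδ hη) hs
  linarith

/-- One-step progress of projected gradient descent on the regularized dual objective. -/
theorem dual_step_progress {η δ c s x y : ℝ} (hη : 0 < η) (hδ : 0 ≤ δ) (hc : c ≤ 1)
    (hx₀ : 0 ≤ x) (hx : δ * x ≤ c) (hy : 0 ≤ y) :
    (δ / 2 * x ^ 2 + x * (s - c)) - (δ / 2 * y ^ 2 + y * (s - c))
      ≤ (x - y) ^ 2 / (2 * η) - (max 0 ((1 - δ * η) * x - η * (s - c)) - y) ^ 2 / (2 * η)
        + η * (s ^ 2 + 1) := by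
  have hproj := sq_max_zero_sub_le (x := (1 - δ * η) * x - η * (s - c)) hy
  have hδx := mul_nonneg hδ hx₀
  have hgrad : (δ * x + s - c) ^ 2 ≤ 2 * (s ^ 2 + 1) := by
    have : (δ * x - c) ^ 2 ≤ 1 := by
      rw [sq_le_one_iff_abs_le_one, abs_le]
      constructor <;> linarith
    nlinarith [sq_nonneg (s - (δ * x - c))]
  have hgrad' := mul_le_mul_of_nonneg_left hgrad (sq_nonneg η)
  have hconvex := mul_nonneg (mul_nonneg hη.le hδ) (sq_nonneg (x - y))
  rw [← sub_div, ← sub_le_iff_le_add, le_div_iff₀ (by positivity)]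
  linarith


/-- Summed dual inequality in the analysis of the BanditLEWA algorithm.
Rounds `t = 1, …, T` are indexed by `t = 0, …, T-1`. -/
theorem bandit_lewa_dual_inequality (K T : ℕ) (hK : 1 ≤ K) (hT : 1 ≤ T)
    (η δ c0 : ℝ) (hη : 0 < η) (hδ : 0 < δ) (hδη : δ * η ≤ 1)
    (hc0 : c0 ∈ Set.Icc (0 : ℝ) 1)
    (chat : ℕ → Fin K → ℝ) (hchat : ∀ t < T, ∀ i, 0 ≤ chat t i)
    (q : ℕ → Fin K → ℝ)
    (hqnn : ∀ t < T, ∀ i, 0 ≤ q t i) (hq1 : ∀ t < T, ∑ i, q t i = 1)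
    (g : ℕ → ℝ → ℝ)
    (hg : ∀ t < T, ∀ x : ℝ, g t x = δ / 2 * x ^ 2 + x * ((∑ i, q t i * chat t i) - c0))
    (lam : ℕ → ℝ) (hlam0 : lam 0 = 0)
    (hlamrec : ∀ t < T,
      lam (t + 1) = max 0 ((1 - δ * η) * lam t - η * ((∑ i, q t i * chat t i) - c0)))
    (lamb : ℝ) (hlamb : 0 ≤ lamb) :
    ∑ t ∈ Finset.range T, (g t (lam t) - g t lamb)
      ≤ lamb ^ 2 / (2 * η)
        + η * ∑ t ∈ Finset.range T, (∑ i, q t i * chat t i) ^ 2 + η * T := by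
  have hs : ∀ t < T, 0 ≤ ∑ i, q t i * chat t i := fun t ht =>
    Finset.sum_nonneg fun i _ => mul_nonneg (hqnn t ht i) (hchat t ht i)
  have hbound : ∀ t ≤ T, 0 ≤ lam t ∧ δ * lam t ≤ c0 := by
    intro t
    induction t with
    | zero => simp [hlam0, hc0.1]
    | succ t ih =>
      intro ht
      rw [hlamrec t ht]
      exact dual_step_mem_Icc hη.le hδ.le hδη hc0.1 (hs t ht) (ih (by lia)).2
  have hstep : ∀ t ∈ Finset.range T, g t (lam t) - g t lamb ≤
      ((lam t - lamb) ^ 2 / (2 * η) - (lam (t + 1) - lamb) ^ 2 / (2 * η))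
        + η * ((∑ i, q t i * chat t i) ^ 2 + 1) := by
    intro t ht
    rw [Finset.mem_range] at ht
    rw [hg t ht, hg t ht, hlamrec t ht]
    exact dual_step_progress hη hδ.le hc0.2 (hbound t ht.le).1 (hbound t ht.le).2 hlamb
  refine (Finset.sum_le_sum hstep).trans ?_
  rw [Finset.sum_add_distrib,
    Finset.sum_range_sub' (fun t => (lam t - lamb) ^ 2 / (2 * η)), ← Finset.mul_sum,
    Finset.sum_add_distrib, hlam0, zero_sub, neg_sq]
  have hlast : 0 ≤ (lam T - lamb) ^ 2 / (2 * η) := by positivity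
  simp only [Finset.sum_const, Finset.card_range, nsmul_eq_mul, mul_one]
  linarith
end

section
/- Let K ≥ 1, T ≥ 1, let r_t ∈ ℝ^K and p_t ∈ Δ_K (t = 1,…,T), and let p ∈ Δ_K. Define r̂_T = (1/T)·Σ_{t=1}^T r_t, p̂_T = (1/T)·Σ_{t=1}^T p_t, and Variation_T = Σ_{t=1}^T ‖r_t − r̂_T‖_∞. Then Σ_{t=1}^T (p_t·r_t − p·r_t) ≤ 2·Variation_T + T·(p̂_T·r̂_T − p·r̂_T). -/
/-- A convex combination of the entries of a vector is bounded by its sup norm. -/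
theorem abs_sum_mul_le_iSup_abs {ι : Type*} [Fintype ι] (w x : ι → ℝ)
    (hw : ∀ i, 0 ≤ w i) (hw1 : ∑ i, w i = 1) :
    |∑ i, w i * x i| ≤ ⨆ i, |x i| :=
  calc |∑ i, w i * x i| ≤ ∑ i, |w i * x i| := Finset.abs_sum_le_sum_abs _ _
    _ ≤ ∑ i, w i * ⨆ j, |x j| := by
        gcongr with i
        rw [abs_mul, abs_of_nonneg (hw i)]
        exact mul_le_mul_of_nonneg_left
          (le_ciSup (f := fun j => |x j|) (Set.finite_range _).bddAbove i) (hw i)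
    _ = ⨆ i, |x i| := by rw [← Finset.sum_mul, hw1, one_mul]


/-- Variation-based decomposition of the (negated) regret (appendix).
Rounds `t = 1, …, T` are indexed by `t = 0, …, T-1`; `‖x‖_∞` is written `⨆ i, |x i|`. -/
theorem variation_decomposition (K T : ℕ) (hK : 1 ≤ K) (hT : 1 ≤ T)
    (r : ℕ → Fin K → ℝ) (p : ℕ → Fin K → ℝ)
    (hpt : ∀ t < T, (∀ i, 0 ≤ p t i) ∧ ∑ i, p t i = 1)
    (q : Fin K → ℝ) (hq : ∀ i, 0 ≤ q i) (hq1 : ∑ i, q i = 1)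
    (rhat phat : Fin K → ℝ)
    (hrhat : ∀ i, rhat i = (∑ t ∈ Finset.range T, r t i) / T)
    (hphat : ∀ i, phat i = (∑ t ∈ Finset.range T, p t i) / T)
    (V : ℝ) (hV : V = ∑ t ∈ Finset.range T, ⨆ i, |r t i - rhat i|) :
    ∑ t ∈ Finset.range T, ((∑ i, p t i * r t i) - ∑ i, q i * r t i)
      ≤ 2 * V + T * ((∑ i, phat i * rhat i) - ∑ i, q i * rhat i) := by
  have hT0 : (T : ℝ) ≠ 0 := by positivity
  have hmean : (T : ℝ) * ((∑ i, phat i * rhat i) - ∑ i, q i * rhat i)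
      = ∑ t ∈ Finset.range T, ((∑ i, p t i * rhat i) - ∑ i, q i * rhat i) := by
    rw [Finset.sum_sub_distrib, Finset.sum_const, Finset.card_range, nsmul_eq_mul, mul_sub,
      Finset.sum_comm, Finset.mul_sum]
    congr 1
    refine Finset.sum_congr rfl fun i _ => ?_
    rw [← Finset.sum_mul, hphat i, ← mul_assoc, mul_div_cancel₀ _ hT0]
  rw [hmean, hV, Finset.mul_sum, ← Finset.sum_add_distrib]
  refine Finset.sum_le_sum fun t ht => ?_
  obtain ⟨hp, hp1⟩ := hpt t (Finset.mem_range.mp ht)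
  have hle := (abs_le.mp (abs_sum_mul_le_iSup_abs (p t) (fun i => r t i - rhat i) hp hp1)).2
  have hge := (abs_le.mp (abs_sum_mul_le_iSup_abs q (fun i => r t i - rhat i) hq hq1)).1
  simp only [mul_sub, Finset.sum_sub_distrib] at hle hge
  linarith
end

section
/- Let K ≥ 1, r̂ ∈ ℝ^K, c ∈ [0,1]^K, c_0 ∈ ℝ, and suppose the feasible set {x ∈ Δ_K : x·c ≥ c_0} is nonempty. Define h(γ) = max{ x·r̂ : x ∈ Δ_K, c_0 − x·c ≤ γ } for γ ≥ 0, and suppose L ≥ 0 is a constant such that h(γ) ≤ h(0) + L·γ for all γ ≥ 0. Let p ∈ Δ_K attain h(0), i.e., p maximizes x·r̂ over {x ∈ Δ_K : x·c ≥ c_0}. Then for any p_1,…,p_T ∈ Δ_K with p̂_T = (1/T)·Σ_{t=1}^T p_t: p̂_T·r̂ − p·r̂ ≤ (L/T)·[ Σ_{t=1}^T (c_0 − p_t·c) ]_+. -/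
/-- A linear functional of an average is the average of the functional. -/
theorem sum_average_mul {ι : Type*} [Fintype ι] (T : ℕ) (y : ℕ → ι → ℝ) (ybar a : ι → ℝ)
    (hybar : ∀ i, ybar i = (∑ t ∈ Finset.range T, y t i) / T) :
    ∑ i, ybar i * a i = (∑ t ∈ Finset.range T, ∑ i, y t i * a i) / T := by
  rw [Finset.sum_comm, Finset.sum_div]
  refine Finset.sum_congr rfl fun i _ => ?_
  rw [hybar, ← Finset.sum_mul]
  ring

/-- A linear functional on the probability simplex is at most the sum of the absolute values
of its coefficients. -/
theorem sum_mul_le_sum_abs_of_mem_simplex {ι : Type*} [Fintype ι] (x r : ι → ℝ)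
    (hx : ∀ i, 0 ≤ x i) (hx1 : ∑ i, x i = 1) : ∑ i, x i * r i ≤ ∑ i, |r i| := by
  refine Finset.sum_le_sum fun i _ => ?_
  have hxi : x i ≤ 1 := hx1 ▸ Finset.single_le_sum (fun j _ => hx j) (Finset.mem_univ i)
  calc x i * r i ≤ x i * |r i| := mul_le_mul_of_nonneg_left (le_abs_self _) (hx i)
    _ ≤ |r i| := mul_le_of_le_one_left (abs_nonneg _) hxi

/-- **Lemma 8.** The average decision's advantage over the constrained optimum is controlled
by the accumulated violation of the constraint, via a linear upper bound on the value
function `h` of the perturbed linear program. Rounds are indexed by `t = 0, …, T-1`. -/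
theorem average_advantage_le_violation (K T : ℕ) (hK : 1 ≤ K) (hT : 1 ≤ T)
    (rhat c : Fin K → ℝ) (hc : ∀ i, c i ∈ Set.Icc (0 : ℝ) 1) (c0 : ℝ)
    (hfeas : ∃ x : Fin K → ℝ, (∀ i, 0 ≤ x i) ∧ (∑ i, x i = 1) ∧ c0 ≤ ∑ i, x i * c i)
    (h : ℝ → ℝ)
    (hh : ∀ γ : ℝ, 0 ≤ γ → h γ = sSup {v : ℝ | ∃ x : Fin K → ℝ,
      (∀ i, 0 ≤ x i) ∧ (∑ i, x i = 1) ∧ c0 - ∑ i, x i * c i ≤ γ ∧ v = ∑ i, x i * rhat i})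
    (L : ℝ) (hL : 0 ≤ L) (hLh : ∀ γ : ℝ, 0 ≤ γ → h γ ≤ h 0 + L * γ)
    (p : Fin K → ℝ) (hpnn : ∀ i, 0 ≤ p i) (hp1 : ∑ i, p i = 1)
    (hpc : c0 ≤ ∑ i, p i * c i)
    (hpopt : ∀ x : Fin K → ℝ, (∀ i, 0 ≤ x i) → (∑ i, x i = 1) →
      c0 ≤ ∑ i, x i * c i → ∑ i, x i * rhat i ≤ ∑ i, p i * rhat i)
    (pt : ℕ → Fin K → ℝ) (hpt : ∀ t < T, (∀ i, 0 ≤ pt t i) ∧ ∑ i, pt t i = 1)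
    (phat : Fin K → ℝ) (hphat : ∀ i, phat i = (∑ t ∈ Finset.range T, pt t i) / T) :
    (∑ i, phat i * rhat i) - ∑ i, p i * rhat i
      ≤ L / T * max 0 (∑ t ∈ Finset.range T, (c0 - ∑ i, pt t i * c i)) := by
  have hT0 : (0 : ℝ) < T := by exact_mod_cast hT
  set S := ∑ t ∈ Finset.range T, (c0 - ∑ i, pt t i * c i) with hS
  have hγ : 0 ≤ max 0 S / T := by positivity
  have hphat_nonneg : ∀ i, 0 ≤ phat i := fun i => by
    rw [hphat]
    exact div_nonneg
      (Finset.sum_nonneg fun t ht => (hpt t (Finset.mem_range.mp ht)).1 i) hT0.le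
  have hphat_sum : ∑ i, phat i = 1 := by
    have hsum := sum_average_mul T pt phat (fun _ => 1) hphat
    simp only [mul_one] at hsum
    rw [hsum, Finset.sum_congr rfl fun t ht => (hpt t (Finset.mem_range.mp ht)).2]
    simp [hT0.ne']
  have hphat_violation : c0 - ∑ i, phat i * c i ≤ max 0 S / T := by
    have heq : c0 - ∑ i, phat i * c i = S / T := by
      rw [sum_average_mul T pt phat c hphat, hS, Finset.sum_sub_distrib]
      simp only [Finset.sum_const, Finset.card_range, nsmul_eq_mul]
      field_simp
    rw [heq]
    exact div_le_div_of_nonneg_right (le_max_right _ _) hT0.le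
  have hphat_le : ∑ i, phat i * rhat i ≤ h (max 0 S / T) := by
    rw [hh _ hγ]
    refine le_csSup ⟨∑ i, |rhat i|, ?_⟩
      ⟨phat, hphat_nonneg, hphat_sum, hphat_violation, rfl⟩
    rintro v ⟨x, hx, hx1, -, rfl⟩
    exact sum_mul_le_sum_abs_of_mem_simplex x rhat hx hx1
  have hzero_le : h 0 ≤ ∑ i, p i * rhat i := by
    rw [hh 0 le_rfl]
    refine csSup_le ⟨_, p, hpnn, hp1, sub_nonpos.mpr hpc, rfl⟩ ?_
    rintro v ⟨x, hx, hx1, hxc, rfl⟩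
    exact hpopt x hx hx1 (sub_nonpos.mp hxc)
  have hvalue := hLh _ hγ
  have hcomm : L * (max 0 S / T) = L / T * max 0 S := by ring
  linarith
end
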